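/- Let ε, δ ∈ (0,1) and ρ ≥ 1, and let L be a feasible PCMC LP with m = m_p + m_c ≥ 1 constraints, δ < m, width at least 32·log(m/δ)/ε², all item values satisfying π^t_j ≤ ρ·OPT(L)·ε²/(32·log(m/δ)), and which is (ε,σ)-stable for some σ ≥ 0. Let s be an integer with ε²·n ≤ s ≤ n and set ε' = ε·√(n/s). Then the fraction of s-element subsets I ⊆ {1,…,n} for which every feasible solution of L^I(1−ε') has value at most (1 + 2σε' + ρε')·(s/n)·OPT(L) is at least 1 − 2δ. -/

import Mathlib

open Finset

noncomputable section

/-- A packing/covering multiple-choice LP with `n` column-blocks, `k` choices per block,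
`m_p` packing constraints and `m_c` covering constraints. -/
structure PCMC (n k mp mc : ℕ) where
  pi : Fin n → Fin k → ℝ
  A : Fin n → Fin mp → Fin k → ℝ
  C : Fin n → Fin mc → Fin k → ℝ
  b : Fin mp → ℝ
  d : Fin mc → ℝ

namespace PCMC

variable {n k mp mc : ℕ}

/-- all the data is nonnegative (right-hand sides positive). -/
def NonnegData (L : PCMC n k mp mc) : Prop :=
  (∀ t j, 0 ≤ L.pi t j) ∧ (∀ t i j, 0 ≤ L.A t i j) ∧ (∀ t i j, 0 ≤ L.C t i j) ∧
  (∀ i, 0 < L.b i) ∧ (∀ i, 0 < L.d i)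

end PCMC

/-- membership in the full simplex `▽^k = {x ∈ [0,1]^k : Σ_j x_j ≤ 1}`. -/
def inFullSimplex {k : ℕ} (x : Fin k → ℝ) : Prop := (∀ j, 0 ≤ x j) ∧ ∑ j, x j ≤ 1

namespace PCMC

variable {n k mp mc : ℕ}

/-- feasibility of a solution of a PCMC LP. -/
def Feasible (L : PCMC n k mp mc) (x : Fin n → Fin k → ℝ) : Prop :=
  (∀ t, inFullSimplex (x t)) ∧
  (∀ i, ∑ t, ∑ j, L.A t i j * x t j ≤ L.b i) ∧
  (∀ i, L.d i ≤ ∑ t, ∑ j, L.C t i j * x t j)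

/-- value of a solution. -/
def value (L : PCMC n k mp mc) (x : Fin n → Fin k → ℝ) : ℝ := ∑ t, ∑ j, L.pi t j * x t j

/-- optimal value of a PCMC LP (the optimal value of an infeasible LP is `0 = sSup ∅`). -/
def opt (L : PCMC n k mp mc) : ℝ := sSup {v : ℝ | ∃ x, L.Feasible x ∧ v = L.value x}

/-- `L(θ)`: the LP obtained by replacing the covering right-hand side `d` by `θ·d`. -/
def scaleCover (L : PCMC n k mp mc) (θ : ℝ) : PCMC n k mp mc :=
  { L with d := fun i => θ * L.d i }

/-- `(ε,σ)`-stability: `OPT(L(1-ε)) ≤ (1+σε)·OPT(L)`. -/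
def Stable (L : PCMC n k mp mc) (ε σ : ℝ) : Prop :=
  (L.scaleCover (1 - ε)).opt ≤ (1 + σ * ε) * L.opt

/-- feasibility of a solution for the restricted LP `L^I(θ)`: only the columns in `I`
are kept, the right-hand sides are scaled by `|I|/n`, and additionally the covering
right-hand side is multiplied by `θ`. -/
def RestFeasible (L : PCMC n k mp mc) (I : Finset (Fin n)) (θ : ℝ)
    (x : Fin n → Fin k → ℝ) : Prop :=
  (∀ t, inFullSimplex (x t)) ∧
  (∀ i, ∑ t ∈ I, ∑ j, L.A t i j * x t j ≤ (I.card : ℝ) / n * L.b i) ∧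
  (∀ i, θ * ((I.card : ℝ) / n * L.d i) ≤ ∑ t ∈ I, ∑ j, L.C t i j * x t j)

/-- value of a solution of the restricted LP `L^I`. -/
def restValue (L : PCMC n k mp mc) (I : Finset (Fin n)) (x : Fin n → Fin k → ℝ) : ℝ :=
  ∑ t ∈ I, ∑ j, L.pi t j * x t j

/-- optimal value of the restricted LP `L^I(θ)` (`0` if infeasible). -/
def restOpt (L : PCMC n k mp mc) (I : Finset (Fin n)) (θ : ℝ) : ℝ :=
  sSup {v : ℝ | ∃ x, L.RestFeasible I θ x ∧ v = L.restValue I x}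

end PCMC

/-- fraction of the `binomial(n,s)` subsets of size `s` satisfying `P`. -/
def subsetFrac (n s : ℕ) (P : Finset (Fin n) → Prop) : ℝ :=
  (Nat.card {I : Finset (Fin n) // I.card = s ∧ P I} : ℝ) /
    (Nat.card {I : Finset (Fin n) // I.card = s} : ℝ)


theorem aux_le_of_forall {S D e : ℝ} (h : ∀ τ : ℝ, 0 < τ → S - τ * D < e) : S ≤ e := by
  by_contra hc
  push Not at hc
  have hD : 0 < |D| + 1 := by positivity
  have h1 := h ((S - e) / (|D| + 1)) (div_pos (by linarith) hD)
  have h2 : (S - e) / (|D| + 1) * D ≤ (S - e) / (|D| + 1) * (|D| + 1) := by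
    apply mul_le_mul_of_nonneg_left
    · linarith [le_abs_self D]
    · exact div_nonneg (by linarith) hD.le
  rw [div_mul_cancel₀ _ hD.ne'] at h2
  linarith

theorem aux_nonneg {S D e : ℝ} (h : ∀ N : ℝ, 0 ≤ N → S - N * D < e) : 0 ≤ D := by
  by_contra hc
  push Not at hc
  have h1 := h (|e - S| / (-D)) (div_nonneg (abs_nonneg _) (by linarith))
  have h2 : |e - S| / (-D) * D = - |e - S| := by
    have : D ≠ 0 := hc.ne
    field_simp
  rw [h2] at h1
  linarith [le_abs_self (e - S)]

theorem aux_lagrange {E ι : Type*} [AddCommGroup E] [Module ℝ E] [Fintype ι] [DecidableEq ι]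
    (K : Set E)
    (f : E → ℝ) (g : ι → E → ℝ) (hf : ConcaveOn ℝ K f) (hg : ∀ i, ConcaveOn ℝ K (g i))
    (v : ℝ) (hv : ∀ x ∈ K, (∀ i, 0 ≤ g i x) → f x ≤ v)
    (x0 : E) (hx0 : x0 ∈ K) (hs : ∀ i, 0 < g i x0) :
    ∃ l : ι → ℝ, (∀ i, 0 ≤ l i) ∧ ∀ x ∈ K, f x + ∑ i, l i * g i x ≤ v := by
  let T : Set ((ι → ℝ) × ℝ) := {p | ∃ x ∈ K, (∀ i, p.1 i < g i x) ∧ p.2 < f x}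
  have hT : T = ⋃ x ∈ K, {p | (∀ i, p.1 i < g i x) ∧ p.2 < f x} := by
    ext p; simp only [T, Set.mem_iUnion, Set.mem_ofPred_eq, exists_prop]
  have hopen : IsOpen T := by
    rw [hT]
    refine isOpen_biUnion fun x _ => ?_
    refine IsOpen.inter ?_ ?_
    · have : {p : (ι → ℝ) × ℝ | ∀ i, p.1 i < g i x} = ⋂ i, {p | p.1 i < g i x} := by
        ext; simp
      change IsOpen {p : (ι → ℝ) × ℝ | ∀ i, p.1 i < g i x}
      rw [this]
      exact isOpen_iInter_of_finite fun i => isOpen_lt (by fun_prop) (by fun_prop)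
    · change IsOpen {p : (ι → ℝ) × ℝ | p.2 < f x}
      exact isOpen_lt (by fun_prop) (by fun_prop)
  have key : ∀ {a b p q r t : ℝ}, 0 ≤ a → 0 ≤ b → a + b = 1 → p < r → q < t →
      a * p + b * q < a * r + b * t := by
    intro a b p q r t ha hb hab h1 h2
    rcases ha.eq_or_lt with h | h
    · subst h
      have : b = 1 := by linarith
      subst this; linarith
    · nlinarith [mul_lt_mul_of_pos_left h1 h, mul_le_mul_of_nonneg_left h2.le hb]
  have hconv : Convex ℝ T := by
    rintro p ⟨x, hx, hx1, hx2⟩ q ⟨y, hy, hy1, hy2⟩ a b ha hb hab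
    refine ⟨a • x + b • y, hf.1 hx hy ha hb hab, fun i => ?_, ?_⟩
    · refine lt_of_lt_of_le ?_ ((hg i).2 hx hy ha hb hab)
      simpa using key ha hb hab (hx1 i) (hy1 i)
    · refine lt_of_lt_of_le ?_ (hf.2 hx hy ha hb hab)
      simpa using key ha hb hab hx2 hy2
  have hnot : ((0 : ι → ℝ), v) ∉ T := by
    rintro ⟨x, hx, h1, h2⟩
    exact absurd (hv x hx fun i => (h1 i).le) (not_le.2 h2)
  obtain ⟨F, hF⟩ := geometric_hahn_banach_open_point hconv hopen hnot
  set c : ι → ℝ := fun i => F (Pi.single i 1, 0) with hc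
  set e : ℝ := F (0, 1) with he
  have hFeq : ∀ (u : ι → ℝ) (w : ℝ), F (u, w) = ∑ i, u i * c i + w * e := by
    intro u w
    have h1 : (u, w) = ∑ i, u i • ((Pi.single i 1 : ι → ℝ), (0:ℝ)) + w • ((0 : ι → ℝ), (1:ℝ)) := by
      ext j
      · simp [Prod.fst_sum, Finset.sum_apply, Pi.single_apply]
      · simp [Prod.snd_sum]
    rw [h1, map_add, map_sum, map_smul]
    simp only [map_smul, smul_eq_mul, hc, he]
  have hF' : ∀ (u : ι → ℝ) (w : ℝ) (x : E), x ∈ K → (∀ i, u i < g i x) → w < f x →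
      ∑ i, u i * c i + w * e < v * e := by
    intro u w x hx h1 h2
    have := hF (u, w) ⟨x, hx, h1, h2⟩
    rw [hFeq, hFeq] at this
    simpa using this
  have he0 : 0 ≤ e := by
    refine aux_nonneg (S := (f x0 - 1) * e) (e := v * e) fun N hN => ?_
    have := hF' 0 (f x0 - 1 - N) x0 hx0 (by simpa using hs) (by linarith)
    simp at this
    linarith
  have hepos : 0 < e := by
    refine he0.lt_of_ne fun h => ?_
    have := hF' 0 (f x0 - 1) x0 hx0 (by simpa using hs) (by linarith)
    simp [← h] at this
  have hcn : ∀ i, 0 ≤ c i := by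
    intro i
    refine aux_nonneg (S := (f x0 - 1) * e) (e := v * e) fun N hN => ?_
    have := hF' (Pi.single i (-N)) (f x0 - 1) x0 hx0 (fun j => by
      by_cases h : j = i
      · subst h; simp; linarith [hs j]
      · simp [h, hs j]) (by linarith)
    simp [Pi.single_apply] at this
    linarith
  refine ⟨fun i => c i / e, fun i => div_nonneg (hcn i) he0, fun x hx => ?_⟩
  have hfin : ∑ i, g i x * c i + f x * e ≤ v * e := by
    refine aux_le_of_forall (D := ∑ i, c i + e) fun τ hτ => ?_
    have := hF' (fun i => g i x - τ) (f x - τ) x hx (fun i => by linarith) (by linarith)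
    simp only [sub_mul, Finset.sum_sub_distrib, ← Finset.mul_sum] at this
    linarith
  have h3 : (f x + ∑ i, c i / e * g i x) * e = ∑ i, g i x * c i + f x * e := by
    rw [add_mul, Finset.sum_mul, add_comm]
    congr 1
    refine Finset.sum_congr rfl fun i _ => ?_
    field_simp
  exact le_of_mul_le_mul_right (by linarith) hepos

theorem aux_choose (n s j : ℕ) (hs : s ≤ n) (hj : j ≤ s) :
    ((n - j).choose (s - j) : ℝ) ≤ ((s : ℝ) / n) ^ j * n.choose s := by
  induction j with
  | zero => simp
  | succ j ih =>
    have ih := ih (by omega)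
    obtain ⟨a, rfl⟩ : ∃ a, s = a + j + 1 := ⟨s - j - 1, by omega⟩
    obtain ⟨b, rfl⟩ : ∃ b, n = b + j + 1 := ⟨n - j - 1, by omega⟩
    have e1 : b + j + 1 - j = b + 1 := by omega
    have e2 : a + j + 1 - j = a + 1 := by omega
    have e3 : b + j + 1 - (j + 1) = b := by omega
    have e4 : a + j + 1 - (j + 1) = a := by omega
    rw [e1, e2] at ih
    rw [e3, e4]
    have h := Nat.add_one_mul_choose_eq b a
    have h' : ((b : ℝ) + 1) * b.choose a = (b + 1).choose (a + 1) * (a + 1) := by exact_mod_cast h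
    have hab : (a : ℝ) ≤ b := by exact_mod_cast (by omega : a ≤ b)
    have hq : ((a : ℝ) + 1) / (b + 1) ≤ ((a + j + 1 : ℕ) : ℝ) / ((b + j + 1 : ℕ) : ℝ) := by
      rw [div_le_div_iff₀ (by positivity) (by positivity)]
      push_cast
      have : (0:ℝ) ≤ j := by positivity
      nlinarith
    have : (b.choose a : ℝ) = ((a : ℝ) + 1) / (b + 1) * (b + 1).choose (a + 1) := by
      field_simp
      linarith
    rw [this, pow_succ]
    calc _ ≤ ((a + j + 1 : ℕ) : ℝ) / ((b + j + 1 : ℕ) : ℝ) *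
          ((((a + j + 1 : ℕ) : ℝ) / ((b + j + 1 : ℕ) : ℝ)) ^ j * ((b + j + 1).choose (a + j + 1))) := by
          gcongr
      _ = _ := by ring

theorem aux_supersets {n : ℕ} (s : ℕ) (hs : s ≤ n) (J : Finset (Fin n)) :
    (#{I ∈ powersetCard s (univ : Finset (Fin n)) | J ⊆ I} : ℝ) ≤
      ((s : ℝ) / n) ^ #J * n.choose s := by
  by_cases hj : #J ≤ s
  · refine le_trans ?_ (aux_choose n s #J hs hj)
    have : (n - #J).choose (s - #J) = #(powersetCard (s - #J) Jᶜ) := by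
      rw [card_powersetCard, card_compl, Fintype.card_fin]
    rw [this]
    norm_cast
    refine card_le_card_of_injOn (fun I => I \ J) ?_ ?_
    · intro I hI
      simp only [coe_filter, Set.mem_ofPred_eq, mem_powersetCard] at hI
      simp only [mem_coe, mem_powersetCard]
      refine ⟨fun x hx => by simp at hx ⊢; exact hx.2, ?_⟩
      rw [card_sdiff_of_subset hI.2, hI.1.2]
    · intro I hI I' hI' h
      simp only [coe_filter, Set.mem_ofPred_eq] at hI hI'
      have h : I \ J = I' \ J := h
      rw [← sdiff_union_of_subset hI.2, h, sdiff_union_of_subset hI'.2]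
  · have : ({I ∈ powersetCard s (univ : Finset (Fin n)) | J ⊆ I}) = ∅ := by
      refine filter_eq_empty_iff.2 fun I hI hJ => hj ?_
      rw [← (mem_powersetCard.1 hI).2]
      exact card_le_card hJ
    rw [this]
    simp
    positivity

theorem aux_prod {n : ℕ} (s : ℕ) (hs : s ≤ n) (w : Fin n → ℝ) (hw : ∀ t, 0 ≤ w t) :
    ∑ I ∈ powersetCard s (univ : Finset (Fin n)), ∏ t ∈ I, (1 + w t) ≤
      n.choose s * Real.exp ((s : ℝ) / n * ∑ t, w t) := by
  have h1 : ∑ I ∈ powersetCard s (univ : Finset (Fin n)), ∏ t ∈ I, (1 + w t) =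
      ∑ J : Finset (Fin n), (#{I ∈ powersetCard s (univ : Finset (Fin n)) | J ⊆ I} : ℝ) *
        ∏ t ∈ J, w t := by
    calc _ = ∑ I ∈ powersetCard s (univ : Finset (Fin n)), ∑ J : Finset (Fin n),
          if J ⊆ I then ∏ t ∈ J, w t else 0 := by
          refine sum_congr rfl fun I _ => ?_
          rw [prod_one_add, ← sum_filter]
          refine sum_congr ?_ fun _ _ => rfl
          ext J; simp
      _ = _ := by
          rw [sum_comm]
          refine sum_congr rfl fun J _ => ?_
          rw [← sum_filter, sum_const, nsmul_eq_mul]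
  rw [h1]
  calc _ ≤ ∑ J : Finset (Fin n), (n.choose s : ℝ) * ∏ t ∈ J, ((s : ℝ) / n * w t) := by
        refine sum_le_sum fun J _ => ?_
        rw [prod_mul_distrib, prod_const]
        have := mul_le_mul_of_nonneg_right (aux_supersets s hs J)
          (prod_nonneg fun t (_ : t ∈ J) => hw t)
        linarith
    _ = n.choose s * ∏ t, (1 + (s : ℝ) / n * w t) := by
        rw [← mul_sum, prod_one_add, powerset_univ]
    _ ≤ _ := by
        gcongr
        rw [mul_sum, Real.exp_sum]
        refine prod_le_prod (fun t _ => ?_) fun t _ => ?_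
        · have := hw t; positivity
        · linarith [Real.add_one_le_exp ((s : ℝ) / n * w t)]

theorem aux_exp_chord {l M v : ℝ} (hM : 0 < M) (hl : 0 ≤ l) (hl1 : l ≤ 1) (h0 : 0 ≤ v) (h1 : v ≤ M) :
    Real.exp (l / M * v) ≤ 1 + (l + l ^ 2) / M * v := by
  have hc := convexOn_exp.2 (Set.mem_univ (0:ℝ)) (Set.mem_univ l)
    (show 0 ≤ 1 - v / M by rw [sub_nonneg, div_le_one hM]; exact h1) (show 0 ≤ v / M by positivity)
    (by ring)
  simp only [smul_eq_mul, mul_zero, zero_add, Real.exp_zero, mul_one] at hc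
  have e : l / M * v = v / M * l := by ring
  have h2 := Real.abs_exp_sub_one_sub_id_le (x := l) (by rwa [abs_of_nonneg hl])
  have h3 := (abs_le.1 h2).2
  have h4 : v / M * Real.exp l ≤ v / M * (1 + l + l ^ 2) := by
    apply mul_le_mul_of_nonneg_left _ (by positivity)
    linarith
  rw [e]
  have e2 : (l + l ^ 2) / M * v = v / M * (l + l ^ 2) := by ring
  rw [e2]
  linarith

/-- Chernoff bound for sampling without replacement -/
theorem aux_chernoff {n : ℕ} (s : ℕ) (hs : s ≤ n) (v : Fin n → ℝ) (M B η : ℝ) (hM : 0 < M)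
    (hv0 : ∀ t, 0 ≤ v t) (hvM : ∀ t, v t ≤ M) (hη0 : 0 ≤ η) (hη1 : η ≤ 1)
    (hB : (s : ℝ) / n * ∑ t, v t ≤ B) :
    (#{I ∈ powersetCard s (univ : Finset (Fin n)) |
      (s : ℝ) / n * ∑ t, v t + η * B < ∑ t ∈ I, v t} : ℝ) ≤
      n.choose s * Real.exp (- (η ^ 2 * B / (4 * M))) := by
  set μ := (s : ℝ) / n * ∑ t, v t with hμ
  set l := η / 2 with hl
  have h1 := aux_prod s hs (fun t => (l + l ^ 2) / M * v t)
    (fun t => by have := hv0 t; positivity)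
  have h2 : (#{I ∈ powersetCard s (univ : Finset (Fin n)) | μ + η * B < ∑ t ∈ I, v t} : ℝ) *
      Real.exp (l / M * (μ + η * B)) ≤
      ∑ I ∈ powersetCard s (univ : Finset (Fin n)), ∏ t ∈ I, (1 + (l + l ^ 2) / M * v t) := by
    rw [← nsmul_eq_mul, ← sum_const]
    calc _ ≤ ∑ I ∈ powersetCard s (univ : Finset (Fin n)) with μ + η * B < ∑ t ∈ I, v t,
            ∏ t ∈ I, (1 + (l + l ^ 2) / M * v t) := by
          refine sum_le_sum fun I hI => ?_
          have hI := (mem_filter.1 hI).2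
          calc _ ≤ Real.exp (l / M * ∑ t ∈ I, v t) := by gcongr
            _ = ∏ t ∈ I, Real.exp (l / M * v t) := by rw [mul_sum, Real.exp_sum]
            _ ≤ _ := prod_le_prod (fun _ _ => (Real.exp_pos _).le) fun t _ =>
                aux_exp_chord hM (by positivity) (by rw [hl]; linarith) (hv0 t) (hvM t)
      _ ≤ _ := by
          refine sum_le_sum_of_subset_of_nonneg (filter_subset _ _) fun I _ _ => ?_
          refine prod_nonneg fun t _ => ?_
          have := hv0 t
          positivity
  have h3 := h2.trans h1
  rw [← le_div_iff₀ (Real.exp_pos _), mul_div_assoc, ← Real.exp_sub] at h3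
  refine h3.trans ?_
  gcongr
  rw [← mul_sum]
  have e1 : (s : ℝ) / n * ((l + l ^ 2) / M * ∑ t, v t) - l / M * (μ + η * B) =
    (η ^ 2 / 4 * μ - η ^ 2 / 2 * B) / M := by
    rw [hμ, hl]; ring
  have e2 : - (η ^ 2 * B / (4 * M)) = (- η ^ 2 / 4 * B) / M := by field_simp
  rw [e1, e2]
  gcongr
  nlinarith [mul_le_mul_of_nonneg_left hB (sq_nonneg η)]

theorem aux_lin {n k : ℕ} (c : Fin n → Fin k → ℝ) (x y : Fin n → Fin k → ℝ) (a b : ℝ) :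
    ∑ t, ∑ j, c t j * (a • x + b • y) t j =
      a * ∑ t, ∑ j, c t j * x t j + b * ∑ t, ∑ j, c t j * y t j := by
  simp only [mul_sum, ← sum_add_distrib]
  refine sum_congr rfl fun t _ => sum_congr rfl fun j _ => ?_
  simp
  ring

theorem aux_simplex_le_one {k : ℕ} {x : Fin k → ℝ} (h : inFullSimplex x) (j : Fin k) : x j ≤ 1 :=
  (single_le_sum (fun i _ => h.1 i) (mem_univ j)).trans h.2

theorem aux_bdd {n k mp mc : ℕ} (L : PCMC n k mp mc) (hpi : ∀ t j, 0 ≤ L.pi t j) :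
    BddAbove {v : ℝ | ∃ x, L.Feasible x ∧ v = L.value x} := by
  refine ⟨∑ t, ∑ j, L.pi t j, ?_⟩
  rintro v ⟨x, hx, rfl⟩
  refine sum_le_sum fun t _ => sum_le_sum fun j _ => ?_
  exact mul_le_of_le_one_right (hpi t j) (aux_simplex_le_one (hx.1 t) j)

theorem aux_dual {n k mp mc : ℕ} (L : PCMC n k mp mc) (hL : L.NonnegData)
    (hfeas : ∃ x, L.Feasible x) (ε : ℝ) (hε0 : 0 < ε) (hε1 : ε < 1) :
    ∃ (α : Fin mp → ℝ) (β : Fin mc → ℝ), (∀ i, 0 ≤ α i) ∧ (∀ i, 0 ≤ β i) ∧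
      ∀ x : Fin n → Fin k → ℝ, (∀ t, inFullSimplex (x t)) →
        L.value x + (∑ i, α i * (L.b i - ∑ t, ∑ j, L.A t i j * x t j) +
          ∑ i, β i * (∑ t, ∑ j, L.C t i j * x t j - (1 - ε) * L.d i)) ≤
          (L.scaleCover (1 - ε)).opt := by
  obtain ⟨hpi, hA, hC, hb, hd⟩ := hL
  obtain ⟨x0, hx0⟩ := hfeas
  let K : Set (Fin n → Fin k → ℝ) := {x | ∀ t, inFullSimplex (x t)}
  have hK : Convex ℝ K := by
    intro x hx y hy a b ha hb hab t
    refine ⟨fun j => ?_, ?_⟩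
    · have h1 := (hx t).1 j
      have h2 := (hy t).1 j
      simp only [Pi.add_apply, Pi.smul_apply, smul_eq_mul]
      positivity
    · simp only [Pi.add_apply, Pi.smul_apply, smul_eq_mul, sum_add_distrib, ← mul_sum]
      nlinarith [mul_le_mul_of_nonneg_left (hx t).2 ha, mul_le_mul_of_nonneg_left (hy t).2 hb]
  let g : Fin mp ⊕ Fin mc → (Fin n → Fin k → ℝ) → ℝ :=
    Sum.elim (fun i x => L.b i - ∑ t, ∑ j, L.A t i j * x t j)
      (fun i x => ∑ t, ∑ j, L.C t i j * x t j - (1 - ε) * L.d i)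
  have hlam := aux_lagrange K L.value g ?_ ?_ (L.scaleCover (1 - ε)).opt ?_ ((1 - ε / 2) • x0) ?_ ?_
  · obtain ⟨l, hl0, hl⟩ := hlam
    refine ⟨fun i => l (Sum.inl i), fun i => l (Sum.inr i), fun i => hl0 _, fun i => hl0 _,
      fun x hx => ?_⟩
    have := hl x hx
    rw [Fintype.sum_sum_type] at this
    exact this
  · refine ⟨hK, fun x hx y hy a b ha hb hab => ?_⟩
    simp only [PCMC.value, smul_eq_mul]
    rw [aux_lin]
  · rintro (i | i)
    · refine ⟨hK, fun x hx y hy a b ha hb hab => ?_⟩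
      simp only [g, Sum.elim_inl, smul_eq_mul]
      rw [aux_lin (fun t j => L.A t i j)]
      have : L.b i = (a + b) * L.b i := by rw [hab, one_mul]
      linarith
    · refine ⟨hK, fun x hx y hy a b ha hb hab => ?_⟩
      simp only [g, Sum.elim_inr, smul_eq_mul]
      rw [aux_lin (fun t j => L.C t i j)]
      have : (1 - ε) * L.d i = (a + b) * ((1 - ε) * L.d i) := by rw [hab, one_mul]
      linarith
  · intro x hx hg
    refine le_csSup (aux_bdd (L.scaleCover (1 - ε)) hpi) ⟨x, ⟨hx, fun i => ?_, fun i => ?_⟩, rfl⟩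
    · have := hg (Sum.inl i)
      simp only [g, Sum.elim_inl] at this
      simp only [PCMC.scaleCover]
      linarith
    · have := hg (Sum.inr i)
      simp only [g, Sum.elim_inr] at this
      simp only [PCMC.scaleCover]
      linarith
  · intro t
    refine ⟨fun j => ?_, ?_⟩
    · have h1 := (hx0.1 t).1 j
      simp only [Pi.smul_apply, smul_eq_mul]
      exact mul_nonneg (by linarith) h1
    · have h1 := (hx0.1 t).2
      have h2 : 0 ≤ ∑ j, x0 t j := sum_nonneg fun j _ => (hx0.1 t).1 j
      simp only [Pi.smul_apply, smul_eq_mul, ← mul_sum]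
      nlinarith
  · have e : ∀ c : Fin n → Fin k → ℝ, ∑ t, ∑ j, c t j * ((1 - ε / 2) • x0) t j =
        (1 - ε / 2) * ∑ t, ∑ j, c t j * x0 t j := by
      intro c
      have := aux_lin c x0 0 (1 - ε / 2) 0
      simpa using this
    rintro (i | i)
    · simp only [g, Sum.elim_inl]
      rw [e (fun t j => L.A t i j)]
      have h1 := hx0.2.1 i
      have h2 := hb i
      have := mul_le_mul_of_nonneg_left h1 (by linarith : 0 ≤ 1 - ε / 2)
      nlinarith
    · simp only [g, Sum.elim_inr]
      rw [e (fun t j => L.C t i j)]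
      have h1 := hx0.2.2 i
      have h2 := hd i
      have := mul_le_mul_of_nonneg_left h1 (by linarith : 0 ≤ 1 - ε / 2)
      nlinarith

theorem aux_argmax {k : ℕ} (r : Fin k → ℝ) :
    ∃ y : Fin k → ℝ, inFullSimplex y ∧ ∀ z, inFullSimplex z → ∑ j, r j * z j ≤ ∑ j, r j * y j := by
  by_cases h : ∃ j, 0 < r j
  · obtain ⟨j1, hj1⟩ := h
    obtain ⟨j0, -, hj0⟩ := exists_max_image univ r ⟨j1, mem_univ _⟩
    refine ⟨Pi.single j0 1, ⟨fun j => ?_, by simp⟩, fun z hz => ?_⟩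
    · by_cases h : j = j0
      · subst h; simp
      · simp [h]
    · have hp : 0 < r j0 := hj1.trans_le (hj0 j1 (mem_univ _))
      calc ∑ j, r j * z j ≤ ∑ j, r j0 * z j := by
            gcongr with j _
            · exact hz.1 j
            · exact hj0 j (mem_univ _)
        _ = r j0 * ∑ j, z j := by rw [mul_sum]
        _ ≤ r j0 := mul_le_of_le_one_right hp.le hz.2
        _ = _ := by simp [Pi.single_apply]
  · push Not at h
    refine ⟨0, ⟨by simp, by simp⟩, fun z hz => ?_⟩
    simp only [Pi.zero_apply, mul_zero, sum_const_zero]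
    exact sum_nonpos fun j _ => mul_nonpos_of_nonpos_of_nonneg (h j) (hz.1 j)

theorem aux_frac {n s : ℕ} (hs : s ≤ n) (P : Finset (Fin n) → Prop) (Q : Finset (Fin n) → Prop)
    [DecidablePred Q] (δ : ℝ)
    (hPQ : ∀ I, #I = s → ¬ Q I → P I)
    (hQ : (#{I ∈ powersetCard s (univ : Finset (Fin n)) | Q I} : ℝ) ≤ n.choose s * δ) :
    1 - δ ≤ subsetFrac n s P := by
  classical
  unfold subsetFrac
  have e1 : Nat.card {I : Finset (Fin n) // I.card = s} = n.choose s := by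
    rw [Nat.card_eq_fintype_card, Fintype.card_finset_len, Fintype.card_fin]
  have hpos : (0:ℝ) < n.choose s := by exact_mod_cast Nat.choose_pos hs
  have e2 : Nat.card {I : Finset (Fin n) // I.card = s ∧ P I} =
      #{I ∈ powersetCard s (univ : Finset (Fin n)) | P I} := by
    rw [Nat.card_eq_fintype_card, Fintype.card_subtype]
    congr 1
    ext I
    simp [mem_powersetCard]
  have e3 := card_filter_add_card_filter_not (s := powersetCard s (univ : Finset (Fin n))) Q
  rw [card_powersetCard, card_univ, Fintype.card_fin] at e3
  have e4 : #{I ∈ powersetCard s (univ : Finset (Fin n)) | ¬ Q I} ≤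
      #{I ∈ powersetCard s (univ : Finset (Fin n)) | P I} := by
    refine card_le_card fun I hI => ?_
    rw [mem_filter] at hI ⊢
    exact ⟨hI.1, hPQ I (mem_powersetCard.1 hI.1).2 hI.2⟩
  rw [e1, e2, le_div_iff₀ hpos]
  have e3' : (#{I ∈ powersetCard s (univ : Finset (Fin n)) | Q I} : ℝ) +
    #{I ∈ powersetCard s (univ : Finset (Fin n)) | ¬ Q I} = n.choose s := by exact_mod_cast e3
  have e4' : (#{I ∈ powersetCard s (univ : Finset (Fin n)) | ¬ Q I} : ℝ) ≤
      #{I ∈ powersetCard s (univ : Finset (Fin n)) | P I} := by exact_mod_cast e4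
  linarith

/-- Sampled LP Lemma, part (c): if `L` is `(ε,σ)`-stable, then for at
least a `1 - 2δ` fraction of the `s`-subsets `I`, every feasible solution of `L^I(1-ε')`
has value at most `(1 + 2σε' + ρε')·(s/n)·OPT(L)`. -/
theorem stmt12 {n k mp mc : ℕ} (L : PCMC n k mp mc) (hL : L.NonnegData)
    (hfeas : ∃ x, L.Feasible x) (hm : 1 ≤ mp + mc)
    (ε δ ρ σ : ℝ) (hε0 : 0 < ε) (hε1 : ε < 1) (hδ0 : 0 < δ) (hδ1 : δ < 1)
    (hρ : 1 ≤ ρ) (hσ : 0 ≤ σ) (hδm : δ < (mp + mc : ℝ))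
    (hstable : L.Stable ε σ)
    -- the width of `L` is at least `32·log(m/δ)/ε²`:
    (hwA : ∀ t i j, L.A t i j ≤ L.b i * ε ^ 2 / (32 * Real.log ((mp + mc : ℝ) / δ)))
    (hwC : ∀ t i j, L.C t i j ≤ L.d i * ε ^ 2 / (32 * Real.log ((mp + mc : ℝ) / δ)))
    -- all item values are at most `ρ·OPT(L)·ε²/(32·log(m/δ))`:
    (hwπ : ∀ t j, L.pi t j ≤ ρ * L.opt * ε ^ 2 / (32 * Real.log ((mp + mc : ℝ) / δ)))
    (s : ℕ) (hs1 : ε ^ 2 * n ≤ (s : ℝ)) (hs2 : s ≤ n)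
    (ε' : ℝ) (hε' : ε' = ε * Real.sqrt ((n : ℝ) / s)) :
    1 - 2 * δ ≤ subsetFrac n s (fun I => ∀ x, L.RestFeasible I (1 - ε') x →
      L.restValue I x ≤ (1 + 2 * σ * ε' + ρ * ε') * ((s : ℝ) / n) * L.opt) := by

  classical
  obtain ⟨hpi, hA, hC, hb, hd⟩ := id hL
  set m : ℝ := (mp + mc : ℝ) with hmdef
  have hm1 : (1:ℝ) ≤ m := by rw [hmdef]; exact_mod_cast hm
  have hlog : 0 < Real.log (m / δ) := Real.log_pos (by rw [lt_div_iff₀ hδ0]; linarith)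
  set ℓ := Real.log (m / δ) with hℓ
  have hopt_le : ∀ x, L.Feasible x → L.value x ≤ L.opt := fun x hx =>
    le_csSup (aux_bdd L hpi) ⟨x, hx, rfl⟩
  have hopt0 : 0 ≤ L.opt := by
    obtain ⟨x, hx⟩ := hfeas
    refine le_trans ?_ (hopt_le x hx)
    exact sum_nonneg fun t _ => sum_nonneg fun j _ => mul_nonneg (hpi t j) ((hx.1 t).1 j)
  have htriv : (∀ I : Finset (Fin n), I.card = s → ∀ x, L.RestFeasible I (1 - ε') x →
      L.restValue I x ≤ (1 + 2 * σ * ε' + ρ * ε') * ((s : ℝ) / n) * L.opt) →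
      1 - 2 * δ ≤ subsetFrac n s (fun I => ∀ x, L.RestFeasible I (1 - ε') x →
      L.restValue I x ≤ (1 + 2 * σ * ε' + ρ * ε') * ((s : ℝ) / n) * L.opt) := by
    intro h
    refine aux_frac hs2 _ (fun _ => False) (2 * δ) (fun I hI _ => h I hI) ?_
    simp
    positivity
  rcases Nat.eq_zero_or_pos n with hn | hn
  · refine htriv fun I hI x _ => ?_
    subst hn
    have : I = ∅ := Subsingleton.elim _ _
    subst this
    simp [PCMC.restValue]
  rcases hopt0.eq_or_lt with hO | hO
  · refine htriv fun I hI x hx => ?_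
    rw [← hO, mul_zero]
    refine sum_nonpos fun t _ => sum_nonpos fun j _ => ?_
    refine mul_nonpos_of_nonpos_of_nonneg ?_ ((hx.1 t).1 j)
    have := hwπ t j
    simpa [← hO] using this
  have hnR : (0:ℝ) < n := by exact_mod_cast hn
  have hsR : (0:ℝ) < s := lt_of_lt_of_le (by positivity) hs1
  have hsn : (s:ℝ) ≤ n := by exact_mod_cast hs2
  have hε'0 : 0 ≤ ε' := by rw [hε']; positivity
  have hε'sq : ε' ^ 2 = ε ^ 2 * (n / s) := by
    rw [hε', mul_pow, Real.sq_sqrt (by positivity)]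
  have hε'1 : ε' ≤ 1 := by
    have : ε' ^ 2 ≤ 1 := by
      rw [hε'sq, ← mul_div_assoc, div_le_one hsR]; exact hs1
    nlinarith
  have hεε' : ε ≤ ε' := by
    rw [hε']
    refine le_mul_of_one_le_right hε0.le ?_
    rw [Real.one_le_sqrt, one_le_div hsR]
    exact hsn
  obtain ⟨α, β, hα, hβ, hdual⟩ := aux_dual L hL hfeas ε hε0 hε1
  set O := L.opt with hOdef
  set v0 := (L.scaleCover (1 - ε)).opt with hv0
  have hst : v0 ≤ (1 + σ * ε) * O := hstable
  set βd := ∑ i, β i * L.d i with hβd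
  set αb := ∑ i, α i * L.b i with hαb
  have hβd_le : βd ≤ σ * O := by
    have h1 : O ≤ v0 - ε * βd := by
      refine csSup_le ?_ ?_
      · obtain ⟨x, hx⟩ := hfeas
        exact ⟨_, x, hx, rfl⟩
      · rintro _ ⟨x, hx, rfl⟩
        have h := hdual x hx.1
        have h2 : 0 ≤ ∑ i, α i * (L.b i - ∑ t, ∑ j, L.A t i j * x t j) :=
          sum_nonneg fun i _ => mul_nonneg (hα i) (by linarith [hx.2.1 i])
        have h3 : ε * βd ≤ ∑ i, β i * (∑ t, ∑ j, L.C t i j * x t j - (1 - ε) * L.d i) := by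
          rw [hβd, mul_sum]
          refine sum_le_sum fun i _ => ?_
          have := mul_le_mul_of_nonneg_left (hx.2.2 i) (hβ i)
          linarith
        linarith
    have h2 : ε * βd ≤ ε * (σ * O) := by linarith
    exact le_of_mul_le_mul_left h2 hε0
  -- reduced values
  set r : Fin n → Fin k → ℝ := fun t j =>
    L.pi t j - ∑ i, α i * L.A t i j + ∑ i, β i * L.C t i j with hr
  have hrsum : ∀ (I : Finset (Fin n)) (x : Fin n → Fin k → ℝ),
      ∑ t ∈ I, ∑ j, r t j * x t j = ∑ t ∈ I, ∑ j, L.pi t j * x t j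
        - ∑ i, α i * ∑ t ∈ I, ∑ j, L.A t i j * x t j
        + ∑ i, β i * ∑ t ∈ I, ∑ j, L.C t i j * x t j := by
    intro I x
    have e : ∀ (q : ℕ) (γ : Fin q → ℝ) (D : Fin n → Fin q → Fin k → ℝ),
        ∑ i, γ i * ∑ t ∈ I, ∑ j, D t i j * x t j =
          ∑ t ∈ I, ∑ j, (∑ i, γ i * D t i j) * x t j := by
      intro q γ D
      simp only [mul_sum, sum_mul]
      rw [sum_comm]
      refine sum_congr rfl fun t _ => ?_
      rw [sum_comm]
      refine sum_congr rfl fun j _ => sum_congr rfl fun i _ => ?_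
      ring
    rw [e mp α L.A, e mc β L.C, ← sum_sub_distrib, ← sum_add_distrib]
    refine sum_congr rfl fun t _ => ?_
    rw [← sum_sub_distrib, ← sum_add_distrib]
    refine sum_congr rfl fun j _ => ?_
    rw [hr]; ring
  choose y hy hymax using fun t => aux_argmax (r t)
  set v : Fin n → ℝ := fun t => ∑ j, r t j * y t j with hv
  have hvn : ∀ t, 0 ≤ v t := by
    intro t
    have := hymax t 0 ⟨by simp, by simp⟩
    simpa using this
  have hVsum : ∑ t, v t + αb - (1 - ε) * βd ≤ v0 := by
    have h := hdual y hy
    have h1 := hrsum univ y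
    have h2 : ∑ i, α i * (L.b i - ∑ t, ∑ j, L.A t i j * y t j) =
        αb - ∑ i, α i * ∑ t, ∑ j, L.A t i j * y t j := by
      simp only [mul_sub, sum_sub_distrib, hαb]
    have h3 : ∑ i, β i * (∑ t, ∑ j, L.C t i j * y t j - (1 - ε) * L.d i) =
        ∑ i, β i * ∑ t, ∑ j, L.C t i j * y t j - (1 - ε) * βd := by
      rw [hβd, mul_sum, ← sum_sub_distrib]
      refine sum_congr rfl fun i _ => ?_
      ring
    rw [h2, h3] at h
    simp only [PCMC.value] at h
    simp only [hv]
    linarith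
  have hβd0 : 0 ≤ βd := sum_nonneg fun i _ => mul_nonneg (hβ i) (hd i).le
  have hαb0 : 0 ≤ αb := sum_nonneg fun i _ => mul_nonneg (hα i) (hb i).le
  set M : ℝ := (ρ + σ) * O * ε ^ 2 / (32 * ℓ) with hM
  have hMpos : 0 < M := by rw [hM]; positivity
  have hvM : ∀ t, v t ≤ M := by
    intro t
    have hrM : ∀ j, r t j ≤ M := by
      intro j
      have h1 : 0 ≤ ∑ i, α i * L.A t i j := sum_nonneg fun i _ => mul_nonneg (hα i) (hA t i j)
      have h2 : ∑ i, β i * L.C t i j ≤ βd * (ε ^ 2 / (32 * ℓ)) := by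
        rw [hβd, sum_mul]
        refine sum_le_sum fun i _ => ?_
        have := mul_le_mul_of_nonneg_left (hwC t i j) (hβ i)
        refine this.trans (le_of_eq ?_)
        ring
      have h3 : βd * (ε ^ 2 / (32 * ℓ)) ≤ σ * O * (ε ^ 2 / (32 * ℓ)) := by gcongr
      have h4 := hwπ t j
      have h5 : M = ρ * O * ε ^ 2 / (32 * ℓ) + σ * O * (ε ^ 2 / (32 * ℓ)) := by rw [hM]; ring
      simp only [hr]
      linarith
    calc v t ≤ ∑ j, M * y t j := by
          refine sum_le_sum fun j _ => ?_
          exact mul_le_mul_of_nonneg_right (hrM j) ((hy t).1 j)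
      _ = M * ∑ j, y t j := by rw [mul_sum]
      _ ≤ M := mul_le_of_le_one_right hMpos.le (hy t).2
  set B : ℝ := (s:ℝ) / n * ((ρ + σ) * O) with hB
  have hVB : (s:ℝ) / n * ∑ t, v t ≤ B := by
    rw [hB]
    have h1 : ∑ t, v t ≤ (ρ + σ) * O := by
      have h2 : (1 - ε) * βd ≤ (1 - ε) * (σ * O) :=
        mul_le_mul_of_nonneg_left hβd_le (by linarith)
      have h3 : 1 * O ≤ ρ * O := mul_le_mul_of_nonneg_right hρ hO.le
      linarith
    gcongr
  have hch := aux_chernoff s hs2 v M B ε' hMpos hvn hvM hε'0 hε'1 hVB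
  have hexp : Real.exp (- (ε' ^ 2 * B / (4 * M))) ≤ 2 * δ := by
    have e1 : ε' ^ 2 * B / (4 * M) = 8 * ℓ := by
      rw [hε'sq, hB, hM]
      have : ρ + σ ≠ 0 := by positivity
      field_simp
      norm_num
    rw [e1]
    calc Real.exp (-(8 * ℓ)) ≤ Real.exp (-ℓ) := by
          apply Real.exp_le_exp.2; linarith
      _ = δ / m := by
          rw [Real.exp_neg, hℓ, Real.exp_log (by positivity), inv_div]
      _ ≤ δ := div_le_self hδ0.le hm1
      _ ≤ 2 * δ := by linarith
  refine aux_frac hs2 _ (fun I => (s : ℝ) / n * ∑ t, v t + ε' * B < ∑ t ∈ I, v t) (2 * δ) ?_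
    (hch.trans (by gcongr))
  intro I hI hQ x hx
  rw [not_lt] at hQ
  have h1 := hrsum I x
  have h2 : ∑ t ∈ I, ∑ j, r t j * x t j ≤ ∑ t ∈ I, v t :=
    sum_le_sum fun t _ => hymax t (x t) (hx.1 t)
  have h3 : ∑ i, α i * ∑ t ∈ I, ∑ j, L.A t i j * x t j ≤ (s:ℝ) / n * αb := by
    rw [hαb, mul_sum]
    refine sum_le_sum fun i _ => ?_
    have h := hx.2.1 i
    rw [hI] at h
    have := mul_le_mul_of_nonneg_left h (hα i)
    linarith
  have h4 : (1 - ε') * ((s:ℝ) / n * βd) ≤ ∑ i, β i * ∑ t ∈ I, ∑ j, L.C t i j * x t j := by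
    rw [hβd, mul_sum, mul_sum]
    refine sum_le_sum fun i _ => ?_
    have h := hx.2.2 i
    rw [hI] at h
    have := mul_le_mul_of_nonneg_left h (hβ i)
    linarith
  have h5 : L.restValue I x ≤ (s:ℝ) / n * (∑ t, v t + αb - (1 - ε') * βd + ε' * ((ρ + σ) * O)) := by
    unfold PCMC.restValue
    rw [hB] at hQ
    linarith
  refine h5.trans ?_
  have h6 : ∑ t, v t + αb - (1 - ε') * βd + ε' * ((ρ + σ) * O) ≤
      (1 + 2 * σ * ε' + ρ * ε') * O := by
    have h7 : (ε' - ε) * βd ≤ (ε' - ε) * (σ * O) :=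
      mul_le_mul_of_nonneg_left hβd_le (by linarith)
    linarith
  calc _ ≤ (s:ℝ) / n * ((1 + 2 * σ * ε' + ρ * ε') * O) := by gcongr
    _ = _ := by ring

end
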